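/- arXiv:math/0307198 — 2 statements merged into one kernel-verified Lean document; each statement's English description precedes it below -/
import Mathlib

section
/- Let f ∈ C²(ℝᵐ, [0,∞)) be strictly convex in the sense that there is C₀ > 0 with ⟨D²f(v)ξ, ξ⟩ ≥ C₀|ξ|² for all v, ξ ∈ ℝᵐ, positively homogeneous of degree α ≥ 1 (f(tp) = t^α f(p) for all t > 0 and p ∈ ℝᵐ), and satisfying f(p) > 0 for all p ≠ 0. Then for every real k ≥ 1 there exists a constant C > 0 such that for all p, q ∈ ℝᵐ: ( f(p)^{k−1} ∇f(p) − f(q)^{k−1} ∇f(q) ) · (p − q) ≥ C |p − q|^{α(k−1)+2}. -/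
theorem add_fderiv_add_sq_le_of_le_fderiv_fderiv {E : Type*} [NormedAddCommGroup E]
    [NormedSpace ℝ E] {f : E → ℝ} (hf : ContDiff ℝ 2 f) {c : ℝ}
    (hc : ∀ v ξ : E, c * ‖ξ‖ ^ 2 ≤ fderiv ℝ (fun x => fderiv ℝ f x) v ξ ξ) (p q : E) :
    f q + fderiv ℝ f q (p - q) + c / 2 * ‖p - q‖ ^ 2 ≤ f p := by
  set d := p - q with hd
  have hline (t : ℝ) : HasDerivAt (fun s : ℝ => q + s • d) d t := by
    simpa using ((hasDerivAt_id t).smul_const d).const_add q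
  have hderiv (t : ℝ) : HasDerivAt (fun s : ℝ => f (q + s • d) - c / 2 * ‖d‖ ^ 2 * s ^ 2)
      (fderiv ℝ f (q + t • d) d - c * ‖d‖ ^ 2 * t) t := by
    have h₁ := ((hf.differentiable (by norm_num)) (q + t • d)).hasFDerivAt.comp_hasDerivAt t
      (hline t)
    refine (h₁.sub ((hasDerivAt_pow 2 t).const_mul (c / 2 * ‖d‖ ^ 2))).congr_deriv ?_
    norm_num
    ring
  have hderiv₂ (t : ℝ) : HasDerivAt (fun s : ℝ => fderiv ℝ f (q + s • d) d - c * ‖d‖ ^ 2 * s)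
      (fderiv ℝ (fun x => fderiv ℝ f x) (q + t • d) d d - c * ‖d‖ ^ 2) t := by
    have hf' : Differentiable ℝ (fun x => fderiv ℝ f x) :=
      (hf.fderiv_right (m := 1) (by norm_num)).differentiable (by norm_num)
    have h₁ : HasDerivAt (fun s : ℝ => fderiv ℝ f (q + s • d))
        (fderiv ℝ (fun x => fderiv ℝ f x) (q + t • d) d) t :=
      (hf' (q + t • d)).hasFDerivAt.comp_hasDerivAt t (hline t)
    have h₂ : HasDerivAt (fun s : ℝ => fderiv ℝ f (q + s • d) d)
        (fderiv ℝ (fun x => fderiv ℝ f x) (q + t • d) d d) t := by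
      simpa using h₁.clm_apply (hasDerivAt_const t d)
    refine (h₂.sub ((hasDerivAt_id t).const_mul (c * ‖d‖ ^ 2))).congr_deriv ?_
    simp
  have hconv : ConvexOn ℝ Set.univ (fun s : ℝ => f (q + s • d) - c / 2 * ‖d‖ ^ 2 * s ^ 2) :=
    convexOn_of_hasDerivWithinAt2_nonneg convex_univ
      (fun t _ => (hderiv t).continuousAt.continuousWithinAt)
      (fun t _ => (hderiv t).hasDerivWithinAt) (fun t _ => (hderiv₂ t).hasDerivWithinAt)
      (fun t _ => sub_nonneg.2 (hc _ _))
  have h := hconv.le_slope_of_hasDerivAt (Set.mem_univ 0) (Set.mem_univ 1) one_pos (hderiv 0)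
  have hqd : q + d = p := add_sub_cancel q p
  norm_num [slope_def_field, -map_sub, hqd] at h
  linarith

theorem exists_mul_norm_rpow_le_of_homogeneous {E : Type*} [NormedAddCommGroup E]
    [NormedSpace ℝ E] [ProperSpace E] {f : E → ℝ} (hf : Continuous f) {α : ℝ} (hα : 0 < α)
    (h0 : 0 ≤ f 0) (hhom : ∀ t : ℝ, 0 < t → ∀ p : E, f (t • p) = t ^ α * f p)
    (hpos : ∀ p : E, p ≠ 0 → 0 < f p) :
    ∃ c : ℝ, 0 < c ∧ ∀ p : E, c * ‖p‖ ^ α ≤ f p := by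
  obtain ⟨c, hc, hle⟩ := (isCompact_sphere (0 : E) 1).exists_forall_le' hf.continuousOn
    (a := 0) fun p hp => hpos p (ne_zero_of_mem_unit_sphere ⟨p, hp⟩)
  refine ⟨c, hc, fun p => ?_⟩
  rcases eq_or_ne p 0 with rfl | hp
  · simpa [Real.zero_rpow hα.ne'] using h0
  have hn : 0 < ‖p‖ := norm_pos_iff.2 hp
  have h := hle (‖p‖⁻¹ • p) (by simp [norm_smul, hn.ne'])
  calc c * ‖p‖ ^ α ≤ f (‖p‖⁻¹ • p) * ‖p‖ ^ α := by gcongr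
    _ = f (‖p‖ • ‖p‖⁻¹ • p) := by rw [hhom _ hn, mul_comm]
    _ = f p := by rw [smul_inv_smul₀ hn.ne']


/-- Claim 5.5: for a strictly convex, `α`-homogeneous `f ∈ C²(ℝᵐ, [0,∞))` with `f(p) > 0` for
`p ≠ 0`, and any `k ≥ 1`, there is `C > 0` with
`(f(p)^{k-1}∇f(p) - f(q)^{k-1}∇f(q)) · (p - q) ≥ C|p - q|^{α(k-1)+2}`. -/
theorem strictly_convex_monotonicity
    {m : ℕ} (f : EuclideanSpace ℝ (Fin m) → ℝ) (hf : ContDiff ℝ 2 f)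
    (hf0 : ∀ p, 0 ≤ f p)
    (C₀ : ℝ) (hC₀ : 0 < C₀)
    -- strict convexity: `⟨D²f(v)ξ, ξ⟩ ≥ C₀|ξ|²` for all `v, ξ`
    (hconv : ∀ v ξ : EuclideanSpace ℝ (Fin m),
      C₀ * ‖ξ‖ ^ 2 ≤ fderiv ℝ (fun x => fderiv ℝ f x) v ξ ξ)
    (α : ℝ) (hα : 1 ≤ α)
    (hhom : ∀ t : ℝ, 0 < t → ∀ p : EuclideanSpace ℝ (Fin m), f (t • p) = t ^ α * f p)
    (hpos : ∀ p : EuclideanSpace ℝ (Fin m), p ≠ 0 → 0 < f p)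
    (k : ℝ) (hk : 1 ≤ k) :
    ∃ C : ℝ, 0 < C ∧ ∀ p q : EuclideanSpace ℝ (Fin m),
      C * ‖p - q‖ ^ (α * (k - 1) + 2) ≤
        f p ^ (k - 1) * fderiv ℝ f p (p - q) - f q ^ (k - 1) * fderiv ℝ f q (p - q) := by
  obtain ⟨c, hc, hcle⟩ := exists_mul_norm_rpow_le_of_homogeneous hf.continuous
    (one_pos.trans_le hα) (hf0 0) hhom hpos
  have hk' : 0 ≤ k - 1 := sub_nonneg.2 hk
  have hα' : 0 ≤ α := zero_le_one.trans hα
  refine ⟨(c * 2⁻¹ ^ α) ^ (k - 1) * (C₀ / 2), by positivity, fun p q => ?_⟩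
  have hgrowth : (c * 2⁻¹ ^ α) ^ (k - 1) * ‖p - q‖ ^ (α * (k - 1)) ≤
      f p ^ (k - 1) + f q ^ (k - 1) := by
    have hlarge (x : EuclideanSpace ℝ (Fin m)) (hx : ‖p - q‖ ≤ 2 * ‖x‖) :
        (c * 2⁻¹ ^ α) ^ (k - 1) * ‖p - q‖ ^ (α * (k - 1)) ≤ f x ^ (k - 1) := by
      rw [Real.rpow_mul (norm_nonneg _), ← Real.mul_rpow (by positivity) (by positivity),
        mul_assoc, ← Real.mul_rpow (by positivity) (by positivity)]
      refine Real.rpow_le_rpow (by positivity) (le_trans ?_ (hcle x)) hk'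
      gcongr
      linarith
    have hp := Real.rpow_nonneg (hf0 p) (k - 1)
    have hq := Real.rpow_nonneg (hf0 q) (k - 1)
    have hsub := norm_sub_le p q
    rcases le_total ‖p‖ ‖q‖ with h | h
    · linarith [hlarge q (by linarith)]
    · linarith [hlarge p (by linarith)]
  have hmono : 0 ≤ (f p ^ (k - 1) - f q ^ (k - 1)) * (f p - f q) := by
    rcases le_total (f p) (f q) with h | h
    · exact mul_nonneg_of_nonpos_of_nonpos
        (sub_nonpos.2 (Real.rpow_le_rpow (hf0 p) h hk')) (sub_nonpos.2 h)
    · exact mul_nonneg (sub_nonneg.2 (Real.rpow_le_rpow (hf0 q) h hk')) (sub_nonneg.2 h)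
  have hpq := mul_le_mul_of_nonneg_left
    (add_fderiv_add_sq_le_of_le_fderiv_fderiv hf hconv p q) (Real.rpow_nonneg (hf0 q) (k - 1))
  have hqp := mul_le_mul_of_nonneg_left
    (add_fderiv_add_sq_le_of_le_fderiv_fderiv hf hconv q p) (Real.rpow_nonneg (hf0 p) (k - 1))
  rw [← neg_sub p q, map_neg, norm_neg] at hqp
  have hsplit : ‖p - q‖ ^ (α * (k - 1) + 2) = ‖p - q‖ ^ (α * (k - 1)) * ‖p - q‖ ^ 2 := by
    rw [Real.rpow_add_of_nonneg (norm_nonneg _) (by positivity) zero_le_two, Real.rpow_two]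
  rw [hsplit]
  have hscaled := mul_le_mul_of_nonneg_right hgrowth
    (show 0 ≤ C₀ / 2 * ‖p - q‖ ^ 2 by positivity)
  linarith
end

section
/- For every real β ≥ 0 there exists a constant C > 0 depending only on β (one may take C = 2^{−β}/(β+1)) such that for all p, q ∈ ℝᵐ: ∫₀¹ |t p + (1−t) q|^β dt ≥ C |p − q|^β. -/
/-- On a segment the norm grows at least linearly in the distance to the parameter of the
point closest to the origin. -/
lemma exists_norm_sub_mul_abs_le_norm_segment {E : Type*} [NormedAddCommGroup E]
    [InnerProductSpace ℝ E] (p q : E) :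
    ∃ s ∈ Set.Icc (0 : ℝ) 1, ∀ t ∈ Set.Icc (0 : ℝ) 1,
      ‖p - q‖ * |t - s| ≤ ‖t • p + (1 - t) • q‖ := by
  rcases eq_or_ne p q with rfl | hpq
  · exact ⟨0, by simp, fun t _ => by simp⟩
  have hd : 0 < ‖p - q‖ := norm_pos_iff.2 (sub_ne_zero.2 hpq)
  set r : ℝ := -(inner ℝ q (p - q)) / ‖p - q‖ ^ 2 with hr
  have hline (t : ℝ) : ‖p - q‖ * |t - r| ≤ ‖t • p + (1 - t) • q‖ := by
    have hinner : inner ℝ (t • p + (1 - t) • q) (p - q) = ‖p - q‖ ^ 2 * (t - r) := by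
      have hv : t • p + (1 - t) • q = q + t • (p - q) := by module
      rw [hv, inner_add_left, real_inner_smul_left, real_inner_self_eq_norm_sq, hr]
      field_simp
      ring
    have hcs := abs_real_inner_le_norm (t • p + (1 - t) • q) (p - q)
    rw [hinner, abs_mul, abs_of_nonneg (sq_nonneg ‖p - q‖)] at hcs
    refine le_of_mul_le_mul_right ?_ hd
    linarith
  refine ⟨max 0 (min 1 r), ⟨le_max_left _ _, max_le zero_le_one (min_le_left _ _)⟩,
    fun t ht => le_trans ?_ (hline t)⟩
  refine mul_le_mul_of_nonneg_left ?_ hd.le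
  obtain ⟨h0, h1⟩ := ht
  rcases le_total r 0 with h | h
  · rw [min_eq_right (h.trans zero_le_one), max_eq_left h, sub_zero, abs_of_nonneg h0]
    exact le_trans (by linarith) (le_abs_self _)
  · rcases le_total r 1 with h' | h'
    · rw [min_eq_right h', max_eq_right h]
    · rw [min_eq_left h', max_eq_right zero_le_one, abs_of_nonpos (by linarith)]
      exact le_trans (by linarith) (neg_le_abs _)

lemma integral_abs_sub_rpow {β s : ℝ} (hβ : 0 ≤ β) (hs : s ∈ Set.Icc (0 : ℝ) 1) :
    ∫ t in (0:ℝ)..1, |t - s| ^ β = (s ^ (β + 1) + (1 - s) ^ (β + 1)) / (β + 1) := by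
  have hc : Continuous fun t : ℝ => |t - s| ^ β :=
    (continuous_id.sub continuous_const).abs.rpow_const fun _ => Or.inr hβ
  have hleft : ∫ t in (0:ℝ)..s, |t - s| ^ β = s ^ (β + 1) / (β + 1) := by
    have h : ∫ t in (0:ℝ)..s, |t - s| ^ β = ∫ t in (0:ℝ)..s, (s - t) ^ β :=
      intervalIntegral.integral_congr fun t ht => by
        rw [Set.uIcc_of_le hs.1] at ht
        rw [abs_sub_comm, abs_of_nonneg (sub_nonneg.2 ht.2)]
    rw [h, intervalIntegral.integral_comp_sub_left (fun x : ℝ => x ^ β),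
      integral_rpow (Or.inl (by linarith)), sub_self, sub_zero,
      Real.zero_rpow (by linarith), sub_zero]
  have hright : ∫ t in s..(1:ℝ), |t - s| ^ β = (1 - s) ^ (β + 1) / (β + 1) := by
    have h : ∫ t in s..(1:ℝ), |t - s| ^ β = ∫ t in s..(1:ℝ), (t - s) ^ β :=
      intervalIntegral.integral_congr fun t ht => by
        rw [Set.uIcc_of_le hs.2] at ht
        rw [abs_of_nonneg (sub_nonneg.2 ht.1)]
    rw [h, intervalIntegral.integral_comp_sub_right (fun x : ℝ => x ^ β),
      integral_rpow (Or.inl (by linarith)), sub_self,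
      Real.zero_rpow (by linarith), sub_zero]
  rw [← intervalIntegral.integral_add_adjacent_intervals (hc.intervalIntegrable 0 s)
    (hc.intervalIntegrable s 1), hleft, hright, add_div]

lemma two_rpow_neg_le_rpow_add_rpow {β s : ℝ} (hβ : 0 ≤ β) (hs : s ∈ Set.Icc (0 : ℝ) 1) :
    (2 : ℝ) ^ (-β) ≤ s ^ (β + 1) + (1 - s) ^ (β + 1) := by
  have h := (convexOn_rpow (p := β + 1) (by linarith)).2 (Set.mem_Ici.2 hs.1)
    (Set.mem_Ici.2 (sub_nonneg.2 hs.2)) (by norm_num : (0 : ℝ) ≤ 1 / 2)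
    (by norm_num : (0 : ℝ) ≤ 1 / 2) (by norm_num)
  simp only [smul_eq_mul] at h
  have hmid : 1 / 2 * s + 1 / 2 * (1 - s) = (2 : ℝ)⁻¹ := by ring
  have hpow : ((2 : ℝ)⁻¹) ^ (β + 1) = 2 ^ (-β) / 2 := by
    rw [Real.rpow_add_one (by norm_num), Real.inv_rpow (by norm_num),
      Real.rpow_neg (by norm_num), div_eq_mul_inv]
  rw [hmid, hpow] at h
  linarith

/-- For every `β ≥ 0` there is a constant `C > 0` depending only on `β`
(one may take `C = 2^{-β}/(β+1)`) such that
`∫₀¹ |tp + (1-t)q|^β dt ≥ C |p - q|^β` for all `p, q ∈ ℝᵐ`. -/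
theorem integral_segment_power_lower_bound (β : ℝ) (hβ : 0 ≤ β) :
    ∃ C : ℝ, 0 < C ∧ C = 2 ^ (-β) / (β + 1) ∧
      ∀ (m : ℕ) (p q : EuclideanSpace ℝ (Fin m)),
        C * ‖p - q‖ ^ β ≤ ∫ t in (0:ℝ)..1, ‖t • p + (1 - t) • q‖ ^ β := by
  refine ⟨2 ^ (-β) / (β + 1), by positivity, rfl, fun m p q => ?_⟩
  obtain ⟨s, hs, hle⟩ := exists_norm_sub_mul_abs_le_norm_segment p q
  have hc : Continuous fun t : ℝ => (‖p - q‖ * |t - s|) ^ β :=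
    (by fun_prop : Continuous fun t : ℝ => ‖p - q‖ * |t - s|).rpow_const fun _ => Or.inr hβ
  have hc' : Continuous fun t : ℝ => ‖t • p + (1 - t) • q‖ ^ β :=
    (by fun_prop : Continuous fun t : ℝ => ‖t • p + (1 - t) • q‖).rpow_const
      fun _ => Or.inr hβ
  calc 2 ^ (-β) / (β + 1) * ‖p - q‖ ^ β
      ≤ (s ^ (β + 1) + (1 - s) ^ (β + 1)) / (β + 1) * ‖p - q‖ ^ β := by
        gcongr
        exact two_rpow_neg_le_rpow_add_rpow hβ hs
    _ = ∫ t in (0:ℝ)..1, (‖p - q‖ * |t - s|) ^ β := by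
        simp_rw [Real.mul_rpow (norm_nonneg (p - q)) (abs_nonneg _)]
        rw [intervalIntegral.integral_const_mul, integral_abs_sub_rpow hβ hs, mul_comm]
    _ ≤ ∫ t in (0:ℝ)..1, ‖t • p + (1 - t) • q‖ ^ β :=
        intervalIntegral.integral_mono_on zero_le_one (hc.intervalIntegrable 0 1)
          (hc'.intervalIntegrable 0 1) fun t ht =>
            Real.rpow_le_rpow (by positivity) (hle t ht) hβ
end
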